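/- Let D' = D'¹ × ⋯ × D'ⁿ be a product Borel probability distribution on [0,∞)ⁿ and let ε > 0. Let D'' be the product distribution obtained by pushing each D'ⁱ forward under the map v ↦ ε·⌊v/ε⌋ (rounding every value down to the closest multiple of ε). Then Opt(D'') ≥ Opt(D') − ε. -/

import Mathlib

open MeasureTheory

/-- A (direct-revelation) mechanism for `n` buyers and one item: an allocation
rule and a payment rule on value profiles. -/
structure Mech (n : ℕ) where
  alloc : (Fin n → ℝ) → Fin n → ℝ
  pay : (Fin n → ℝ) → Fin n → ℝ

/-- Allocation probabilities are in `[0,1]` and sum to at most `1`. -/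
def Mech.Valid {n : ℕ} (M : Mech n) : Prop :=
  ∀ v : Fin n → ℝ, (∀ i, 0 ≤ M.alloc v i ∧ M.alloc v i ≤ 1) ∧ ∑ i, M.alloc v i ≤ 1

/-- Dominant strategy incentive compatibility (on nonnegative value profiles). -/
def Mech.DSIC {n : ℕ} (M : Mech n) : Prop :=
  ∀ (i : Fin n) (v : Fin n → ℝ), (∀ j, 0 ≤ v j) → ∀ v' : ℝ, 0 ≤ v' →
    v i * M.alloc (Function.update v i v') i - M.pay (Function.update v i v') i ≤
      v i * M.alloc v i - M.pay v i

/-- Individual rationality (on nonnegative value profiles). -/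
def Mech.IR {n : ℕ} (M : Mech n) : Prop :=
  ∀ v : Fin n → ℝ, (∀ j, 0 ≤ v j) → ∀ i, 0 ≤ v i * M.alloc v i - M.pay v i

/-- Measurability of the allocation and payment rules. -/
def Mech.Meas {n : ℕ} (M : Mech n) : Prop :=
  (∀ i, Measurable fun v => M.alloc v i) ∧ (∀ i, Measurable fun v => M.pay v i)

/-- A measurable DSIC and IR mechanism. -/
def Mech.Good {n : ℕ} (M : Mech n) : Prop := M.Valid ∧ M.DSIC ∧ M.IR ∧ M.Meas

/-- Expected revenue of mechanism `M` on value distribution `D`. -/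
noncomputable def Rev {n : ℕ} (M : Mech n) (D : Measure (Fin n → ℝ)) : ℝ :=
  ∫ v, ∑ i, M.pay v i ∂D

/-- Optimal revenue: supremum of revenue over measurable DSIC and IR mechanisms. -/
noncomputable def Opt {n : ℕ} (D : Measure (Fin n → ℝ)) : ℝ :=
  sSup {r : ℝ | ∃ M : Mech n, M.Good ∧ r = Rev M D}



noncomputable def cell {n : ℕ} (ε : ℝ) (v : Fin n → ℝ) : Fin n → ℕ := fun i => ⌊v i / ε⌋₊

noncomputable def spay {n : ℕ} (ε : ℝ) (X : (Fin n → ℕ) → Fin n → ℝ) (c : Fin n → ℕ) (i : Fin n) : ℝ :=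
  ε * ((c i : ℝ) * X c i - ∑ j ∈ Finset.range (c i), X (Function.update c i j) i)

noncomputable def stepMech {n : ℕ} (ε : ℝ) (X : (Fin n → ℕ) → Fin n → ℝ) : Mech n :=
  ⟨fun v => X (cell ε v), fun v => spay ε X (cell ε v)⟩

structure StepOK {n : ℕ} (X : (Fin n → ℕ) → Fin n → ℝ) : Prop where
  nonneg : ∀ c i, 0 ≤ X c i
  sum_le : ∀ c, ∑ i, X c i ≤ 1
  mono : ∀ c i, Monotone fun j : ℕ => X (Function.update c i j) i

lemma StepOK.le_one {n : ℕ} {X : (Fin n → ℕ) → Fin n → ℝ} (h : StepOK X) (c i) : X c i ≤ 1 :=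
  le_trans (Finset.single_le_sum (f := fun i => X c i) (fun i _ => h.nonneg c i) (Finset.mem_univ i))
    (h.sum_le c)

lemma step_aux (g : ℕ → ℝ) (hg : Monotone g) (t : ℝ) (ht : 0 ≤ t) (m : ℕ) :
    t * g m - (m * g m - ∑ j ∈ Finset.range m, g j) ≤
    t * g ⌊t⌋₊ - (⌊t⌋₊ * g ⌊t⌋₊ - ∑ j ∈ Finset.range ⌊t⌋₊, g j) := by
  set k := ⌊t⌋₊ with hk
  have h1 : (k : ℝ) ≤ t := Nat.floor_le ht
  have h2 : t < k + 1 := Nat.lt_floor_add_one t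
  let F : ℕ → ℝ := fun m => t * g m - (m * g m - ∑ j ∈ Finset.range m, g j)
  have hF : ∀ m, F (m + 1) - F m = (t - (m + 1)) * (g (m + 1) - g m) := by
    intro m
    simp only [F, Finset.sum_range_succ]
    push_cast
    ring
  have hd : ∀ m, 0 ≤ g (m + 1) - g m := fun m => sub_nonneg.2 (hg (Nat.le_succ m))
  change F m ≤ F k
  rcases le_total m k with h | h
  · have : ∀ d, ∀ m, m + d = k → F m ≤ F k := by
      intro d
      induction d with
      | zero => intro m h; simp at h; rw [h]
      | succ d ih =>
        intro m h
        refine le_trans ?_ (ih (m + 1) (by omega))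
        have : ((m + 1 : ℕ) : ℝ) ≤ k := by exact_mod_cast (by omega : m + 1 ≤ k)
        push_cast at this
        have := mul_nonneg (by linarith : 0 ≤ t - (m + 1)) (hd m)
        linarith [hF m]
    exact this (k - m) m (by omega)
  · induction m, h using Nat.le_induction with
    | base => exact le_rfl
    | succ m h ih =>
      refine le_trans ?_ ih
      have : (k : ℝ) ≤ m := by exact_mod_cast h
      have := mul_nonneg (by linarith : 0 ≤ (m + 1) - t) (hd m)
      linarith [hF m]

lemma cell_update {n : ℕ} (ε : ℝ) (v : Fin n → ℝ) (i : Fin n) (t : ℝ) :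
    cell ε (Function.update v i t) = Function.update (cell ε v) i ⌊t / ε⌋₊ := by
  ext j
  by_cases h : j = i
  · subst h; simp [cell]
  · simp [cell, h]

lemma spay_update {n : ℕ} (ε : ℝ) (X : (Fin n → ℕ) → Fin n → ℝ) (c : Fin n → ℕ) (i : Fin n) (m : ℕ) :
    spay ε X (Function.update c i m) i =
      ε * ((m : ℝ) * X (Function.update c i m) i
        - ∑ j ∈ Finset.range m, X (Function.update c i j) i) := by
  simp [spay]

lemma measurable_cell {n : ℕ} (ε : ℝ) : Measurable (cell (n := n) ε) := by
  unfold cell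
  refine measurable_pi_lambda _ fun i => ?_
  exact Nat.measurable_floor.comp (by fun_prop : Measurable fun c : Fin n → ℝ => c i / ε)

lemma spay_nonneg {n : ℕ} {ε : ℝ} (hε : 0 < ε) {X : (Fin n → ℕ) → Fin n → ℝ} (h : StepOK X) (c i) :
    0 ≤ spay ε X c i := by
  refine mul_nonneg hε.le (sub_nonneg.2 ?_)
  have : ∀ j ∈ Finset.range (c i), X (Function.update c i j) i ≤ X c i := by
    intro j hj
    have := h.mono c i (Finset.mem_range.1 hj).le
    simpa using this
  simpa using Finset.sum_le_card_nsmul _ _ _ this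

lemma step_good {n : ℕ} {ε : ℝ} (hε : 0 < ε) {X : (Fin n → ℕ) → Fin n → ℝ} (h : StepOK X) :
    (stepMech ε X).Good := by
  have key : ∀ (i : Fin n) (v : Fin n → ℝ), (∀ j, 0 ≤ v j) → ∀ m : ℕ,
      v i * X (Function.update (cell ε v) i m) i - spay ε X (Function.update (cell ε v) i m) i ≤
      v i * X (cell ε v) i - spay ε X (cell ε v) i := by
    intro i v hv m
    have := step_aux (fun j => X (Function.update (cell ε v) i j) i) (h.mono _ i) (v i / ε)
      (div_nonneg (hv i) hε.le) m
    have e : Function.update (cell ε v) i ⌊v i / ε⌋₊ = cell ε v := Function.update_eq_self i (cell ε v)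
    have h2 := mul_le_mul_of_nonneg_left this hε.le
    have e2 := spay_update ε X (cell ε v) i ⌊v i / ε⌋₊
    rw [e] at e2
    rw [spay_update, e2]
    simp only [e] at h2
    rw [mul_sub, mul_sub ε (v i / ε * _), ← mul_assoc, ← mul_assoc ε (v i / ε), mul_div_cancel₀ _ hε.ne'] at h2
    exact h2
  refine ⟨fun v => ⟨fun i => ⟨h.nonneg _ _, h.le_one _ _⟩, h.sum_le _⟩, ?_, ?_, ?_, ?_⟩
  · intro i v hv v' hv'
    simp only [stepMech, cell_update]
    exact key i v hv _
  · intro v hv i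
    refine le_trans ?_ (key i v hv 0)
    rw [spay_update]
    simp
    exact mul_nonneg (hv i) (h.nonneg _ _)
  · intro i
    exact (measurable_of_countable (fun c => X c i)).comp (measurable_cell ε)
  · intro i
    exact (measurable_of_countable (fun c => spay ε X c i)).comp (measurable_cell ε)

/-- utilities at grid points -/
lemma util_grid {n : ℕ} {ε : ℝ} (hε : 0 < ε) {M : Mech n} (hM : M.Good) (i : Fin n) (v : Fin n → ℝ)
    (hv : ∀ j, 0 ≤ v j) (k : ℕ) :
    ε * ∑ j ∈ Finset.range k, M.alloc (Function.update v i (ε * j)) i ≤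
      (ε * k) * M.alloc (Function.update v i (ε * k)) i - M.pay (Function.update v i (ε * k)) i := by
  have hu : ∀ k : ℕ, ∀ j, 0 ≤ Function.update v i (ε * k) j := by
    intro k j
    by_cases h : j = i
    · subst h; simp; positivity
    · simp [h, hv j]
  induction k with
  | zero => 
    have := hM.2.2.1 _ (hu 0) i
    simpa using this
  | succ k ih =>
    have := hM.2.1 i _ (hu (k + 1)) (ε * k) (by positivity)
    simp only [Function.update_idem, Function.update_self] at this
    rw [Finset.sum_range_succ]
    push_cast at *
    nlinarith

lemma alloc_mono {n : ℕ} {M : Mech n} (hM : M.Good) (i : Fin n) (v : Fin n → ℝ)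
    (hv : ∀ j, 0 ≤ v j) (s : ℝ) (hs : v i ≤ s) :
    M.alloc v i ≤ M.alloc (Function.update v i s) i := by
  have hs0 : 0 ≤ s := (hv i).trans hs
  have hu : ∀ j, 0 ≤ Function.update v i s j := by
    intro j
    by_cases h : j = i
    · subst h; simpa
    · simp [h, hv j]
  have h1 := hM.2.1 i v hv s hs0
  have h2 := hM.2.1 i _ hu (v i) (hv i)
  simp only [Function.update_idem, Function.update_self, Function.update_eq_self] at h2
  rcases hs.eq_or_lt with h | h
  · rw [← h]; simp
  · by_contra hc
    push Not at hc
    nlinarith [mul_pos (sub_pos.2 h) (sub_pos.2 hc)]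

/-- pointwise payment bound -/
lemma pay_bound {n : ℕ} {ε : ℝ} (hε : 0 < ε) {M : Mech n} (hM : M.Good) (i : Fin n) (v : Fin n → ℝ)
    (hv : ∀ j, 0 ≤ v j) (k : ℕ) (h1 : ε * k ≤ v i) (h2 : v i ≤ ε * (k + 1)) :
    M.pay v i ≤ ε * ((k + 1) * M.alloc v i
      - ∑ j ∈ Finset.range (k + 1), M.alloc (Function.update v i (ε * j)) i) := by
  have hu := util_grid hε hM i v hv k
  have hd := hM.2.1 i v hv (ε * k) (by positivity)
  have hm := alloc_mono hM i (Function.update v i (ε * k)) (by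
    intro j
    by_cases h : j = i
    · subst h; simp; positivity
    · simp [h, hv j]) (v i) (by simpa)
  simp only [Function.update_idem, Function.update_eq_self] at hm
  rw [Finset.sum_range_succ]
  nlinarith [mul_nonneg (sub_nonneg.2 h2) (sub_nonneg.2 hm)]

lemma zero_le_Opt {n : ℕ} (D : Measure (Fin n → ℝ)) : 0 ≤ Opt D := by
  unfold Opt
  by_cases h : BddAbove {r : ℝ | ∃ M : Mech n, M.Good ∧ r = Rev M D}
  · refine le_csSup h ⟨⟨fun _ _ => 0, fun _ _ => 0⟩, ⟨?_, ?_, ?_, ?_, ?_⟩, ?_⟩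
    · intro v; simp
    · intro i v; simp
    · intro v; simp
    · intro i; exact measurable_const
    · intro i; exact measurable_const
    · simp [Rev]
  · rw [Real.sSup_of_not_bddAbove h]

lemma trunc_ok {n : ℕ} {X : (Fin n → ℕ) → Fin n → ℝ} (h : StepOK X) (N : ℕ) :
    StepOK (fun c => X (fun i => min (c i) N)) := by
  refine ⟨fun c i => h.nonneg _ _, fun c => h.sum_le _, fun c i a b hab => ?_⟩
  have e : ∀ a : ℕ, (fun l => min (Function.update c i a l) N) =
      Function.update (fun l => min (c l) N) i (min a N) := by
    intro a; ext l
    by_cases hl : l = i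
    · subst hl; simp
    · simp [hl]
  simp only [e]
  exact h.mono _ i (min_le_min_right N hab)

lemma trunc_spay {n : ℕ} (ε : ℝ) (X : (Fin n → ℕ) → Fin n → ℝ) (N : ℕ) (c i) :
    spay ε (fun c => X (fun i => min (c i) N)) c i = spay ε X (fun i => min (c i) N) i := by
  have e : ∀ a : ℕ, (fun l => min (Function.update c i a l) N) =
      Function.update (fun l => min (c l) N) i (min a N) := by
    intro a; ext l
    by_cases hl : l = i
    · subst hl; simp
    · simp [hl]
  simp only [spay, e]
  congr 1
  set b := (fun l => min (c l) N) with hb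
  have hbi : b i = min (c i) N := rfl
  rcases le_total (c i) N with h | h
  · rw [min_eq_left h]
    congr 1
    refine Finset.sum_congr rfl fun j hj => ?_
    rw [min_eq_left ((Finset.mem_range.1 hj).le.trans h)]
  · rw [min_eq_right h]
    obtain ⟨d, hd⟩ := Nat.exists_eq_add_of_le h
    have hX : Function.update b i N = b := by
      rw [Function.update_eq_self_iff, hbi, min_eq_right h]
    rw [hd, Finset.sum_range_add]
    have h1 : ∑ j ∈ Finset.range N, X (Function.update b i (min j N)) i
        = ∑ j ∈ Finset.range N, X (Function.update b i j) i := by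
      refine Finset.sum_congr rfl fun j hj => ?_
      rw [min_eq_left (Finset.mem_range.1 hj).le]
    rw [h1]
    simp [hX]
    ring

lemma spay_le {n : ℕ} {ε : ℝ} (hε : 0 < ε) {X : (Fin n → ℕ) → Fin n → ℝ} (h : StepOK X) (c i) :
    spay ε X c i ≤ ε * c i := by
  refine mul_le_mul_of_nonneg_left ?_ hε.le
  have h1 : 0 ≤ ∑ j ∈ Finset.range (c i), X (Function.update c i j) i :=
    Finset.sum_nonneg fun j _ => h.nonneg _ _
  have h2 := mul_le_mul_of_nonneg_left (h.le_one c i) (Nat.cast_nonneg (α := ℝ) (c i))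
  linarith

lemma step_integrable {n : ℕ} {ε : ℝ} (hε : 0 < ε) {X : (Fin n → ℕ) → Fin n → ℝ} (h : StepOK X)
    (D : Measure (Fin n → ℝ)) [IsProbabilityMeasure D]
    (hb : BddAbove {r : ℝ | ∃ M : Mech n, M.Good ∧ r = Rev M D}) :
    Integrable (fun v => ∑ i, spay ε X (cell ε v) i) D := by
  obtain ⟨B, hB⟩ := hb
  let R : (Fin n → ℕ) → ℝ := fun c => ∑ i, spay ε X c i
  let T : ℕ → (Fin n → ℕ) → (Fin n → ℕ) := fun N c i => min (c i) N
  have hm : ∀ g : (Fin n → ℕ) → ℝ, Measurable fun v : Fin n → ℝ => g (cell ε v) := fun g =>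
    (measurable_of_countable g).comp (measurable_cell ε)
  have hR0 : ∀ c, 0 ≤ R c := fun c => Finset.sum_nonneg fun i _ => spay_nonneg hε h c i
  have hle : ∀ N, ∫⁻ v, ENNReal.ofReal (R (T N (cell ε v))) ∂D ≤ ENNReal.ofReal B := by
    intro N
    have hi : Integrable (fun v => R (T N (cell ε v))) D := by
      refine Integrable.of_bound (hm (fun c => R (T N c))).aestronglyMeasurable (∑ i : Fin n, ε * N) ?_
      refine Filter.Eventually.of_forall fun v => ?_
      rw [Real.norm_of_nonneg (hR0 _)]
      refine Finset.sum_le_sum fun i _ => (spay_le hε h _ i).trans ?_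
      refine mul_le_mul_of_nonneg_left ?_ hε.le
      exact_mod_cast min_le_right _ _
    rw [← ofReal_integral_eq_lintegral_ofReal hi (Filter.Eventually.of_forall fun v => hR0 _)]
    refine ENNReal.ofReal_le_ofReal (hB ⟨_, step_good hε (trunc_ok h N), ?_⟩)
    simp only [Rev, stepMech, trunc_spay]
    rfl
  have hlim : ∫⁻ v, ENNReal.ofReal (R (cell ε v)) ∂D ≤ ENNReal.ofReal B := by
    have hF := lintegral_liminf_le (μ := D) (u := Filter.atTop)
      (f := fun N v => ENNReal.ofReal (R (T N (cell ε v))))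
      (fun N => (hm (fun c => R (T N c))).ennreal_ofReal)
    have : ∀ v : Fin n → ℝ, Filter.liminf (fun N => ENNReal.ofReal (R (T N (cell ε v)))) Filter.atTop
        = ENNReal.ofReal (R (cell ε v)) := by
      intro v
      refine Filter.Tendsto.liminf_eq (tendsto_const_nhds.congr' ?_)
      filter_upwards [Filter.eventually_ge_atTop (∑ i, cell ε v i)] with N hN
      have : T N (cell ε v) = cell ε v := by
        ext i
        exact min_eq_left ((Finset.single_le_sum (fun _ _ => Nat.zero_le _) (Finset.mem_univ i)).trans hN)
      rw [this]
    simp only [this] at hF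
    refine hF.trans ?_
    refine Filter.liminf_le_of_le (by isBoundedDefault) ?_
    intro b hb
    obtain ⟨N, hN⟩ := hb.exists
    exact hN.trans (hle N)
  refine ⟨(hm R).aestronglyMeasurable, ?_⟩
  rw [hasFiniteIntegral_iff_ofReal (Filter.Eventually.of_forall fun v => hR0 _)]
  exact hlim.trans_lt ENNReal.ofReal_lt_top

lemma pi_update_map {n : ℕ} (μ : Fin n → Measure ℝ) [∀ i, IsProbabilityMeasure (μ i)] (i : Fin n)
    (ν : Measure ℝ) [IsProbabilityMeasure ν] (t : ℝ) :
    (Measure.pi (Function.update μ i ν)).map (fun v => Function.update v i t)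
      = (Measure.pi μ).map (fun v => Function.update v i t) := by
  have key : ∀ (μ : Fin n → Measure ℝ) [∀ i, IsProbabilityMeasure (μ i)],
      (Measure.pi μ).map (fun v => Function.update v i t) =
        Measure.pi fun j => (μ j).map (if j = i then fun _ => t else id) := by
    intro μ _
    have hm : ∀ j, Measurable (if j = i then fun _ : ℝ => t else id) := by
      intro j; split_ifs
      · exact measurable_const
      · exact measurable_id
    have hs : ∀ j, IsProbabilityMeasure ((μ j).map (if j = i then fun _ => t else id)) := fun j =>
      Measure.isProbabilityMeasure_map (hm j).aemeasurable
    rw [← Measure.pi_map_pi (fun j => (hm j).aemeasurable)]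
    congr 1
    ext v j
    by_cases h : j = i
    · subst h; simp
    · simp [h]
  have hp : ∀ j, IsProbabilityMeasure (Function.update μ i ν j) := by
    intro j
    by_cases h : j = i
    · subst h; simpa
    · simp only [Function.update_of_ne h]; infer_instance
  rw [key, key]
  congr 1
  ext1 j
  by_cases h : j = i
  · subst h
    simp [Measure.map_const]
  · simp [h]

section resample
variable {n : ℕ} {ε : ℝ} (κ : Fin n → ℕ → Measure ℝ) 

/-- resampling measure on a cell -/
noncomputable def cellMeas (κ : Fin n → ℕ → Measure ℝ) (c : Fin n → ℕ) : Measure (Fin n → ℝ) :=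
  Measure.pi fun i => κ i (c i)

instance cellMeas_prob [∀ i k, IsProbabilityMeasure (κ i k)] (c : Fin n → ℕ) :
    IsProbabilityMeasure (cellMeas κ c) := by
  unfold cellMeas; infer_instance

noncomputable def resX (κ : Fin n → ℕ → Measure ℝ) (M : Mech n) (c : Fin n → ℕ) (i : Fin n) : ℝ :=
  ∫ v, M.alloc v i ∂(cellMeas κ c)

lemma cell_ae [∀ i k, IsProbabilityMeasure (κ i k)]
    (hκ : ∀ (i : Fin n) (k : ℕ), ∀ᵐ t ∂(κ i k), t ∈ Set.Ico (ε * k) (ε * (k + 1))) (c : Fin n → ℕ) :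
    ∀ᵐ v ∂(cellMeas κ c), ∀ i, v i ∈ Set.Ico (ε * c i) (ε * (c i + 1)) := by
  rw [ae_all_iff]
  intro i
  exact (measurePreserving_eval (fun i => κ i (c i)) i).quasiMeasurePreserving.ae (hκ i (c i))

lemma alloc_int {M : Mech n} (hM : M.Good) (μ : Measure (Fin n → ℝ)) [IsProbabilityMeasure μ]
    (i : Fin n) : Integrable (fun v => M.alloc v i) μ := by
  refine Integrable.of_bound (hM.2.2.2.1 i).aestronglyMeasurable 1 ?_
  refine Filter.Eventually.of_forall fun v => ?_
  rw [Real.norm_of_nonneg ((hM.1 v).1 i).1]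
  exact ((hM.1 v).1 i).2

lemma measurable_upd (i : Fin n) (t : ℝ) : Measurable fun v : Fin n → ℝ => Function.update v i t := by
  refine measurable_pi_lambda _ fun j => ?_
  by_cases h : j = i
  · subst h; simp
  · simp only [Function.update_of_ne h]; exact measurable_pi_apply j

lemma alloc_upd_int {M : Mech n} (hM : M.Good) (μ : Measure (Fin n → ℝ)) [IsProbabilityMeasure μ]
    (i : Fin n) (t : ℝ) : Integrable (fun v => M.alloc (Function.update v i t) i) μ := by
  refine Integrable.of_bound
    ((hM.2.2.2.1 i).comp (measurable_upd i t)).aestronglyMeasurable 1 ?_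
  refine Filter.Eventually.of_forall fun v => ?_
  rw [Real.norm_of_nonneg ((hM.1 _).1 i).1]
  exact ((hM.1 _).1 i).2

lemma resZ [∀ i k, IsProbabilityMeasure (κ i k)] {M : Mech n} (hM : M.Good) (c : Fin n → ℕ)
    (i : Fin n) (k : ℕ) (t : ℝ) :
    ∫ v, M.alloc (Function.update v i t) i ∂(cellMeas κ (Function.update c i k)) =
    ∫ v, M.alloc (Function.update v i t) i ∂(cellMeas κ c) := by
  have h1 : ∀ μ : Measure (Fin n → ℝ), ∫ v, M.alloc (Function.update v i t) i ∂μ =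
      ∫ v, M.alloc v i ∂(μ.map fun v => Function.update v i t) := fun μ =>
    (integral_map (measurable_upd i t).aemeasurable (hM.2.2.2.1 i).aestronglyMeasurable).symm
  rw [h1, h1]
  congr 1
  have := pi_update_map (fun j => κ j (c j)) i (κ i k) t
  unfold cellMeas
  rw [← this]
  congr 2
  ext1 j
  by_cases h : j = i
  · subst h; simp
  · simp [h]

lemma resX_le (hε : 0 < ε) [∀ i k, IsProbabilityMeasure (κ i k)]
    (hκ : ∀ (i : Fin n) (k : ℕ), ∀ᵐ t ∂(κ i k), t ∈ Set.Ico (ε * k) (ε * (k + 1)))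
    {M : Mech n} (hM : M.Good) (c : Fin n → ℕ) (i : Fin n) (k : ℕ) :
    resX κ M (Function.update c i k) i ≤
      ∫ v, M.alloc (Function.update v i (ε * (k + 1 : ℕ))) i ∂(cellMeas κ c) := by
  rw [← resZ κ hM c i k]
  refine integral_mono_ae (alloc_int hM _ i) (alloc_upd_int hM _ i _) ?_
  filter_upwards [cell_ae κ hκ (Function.update c i k)] with v hv
  refine alloc_mono hM i v (fun j => le_trans (by positivity) (hv j).1) _ ?_
  have := (hv i).2.le
  simpa using this

lemma le_resX (hε : 0 < ε) [∀ i k, IsProbabilityMeasure (κ i k)]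
    (hκ : ∀ (i : Fin n) (k : ℕ), ∀ᵐ t ∂(κ i k), t ∈ Set.Ico (ε * k) (ε * (k + 1)))
    {M : Mech n} (hM : M.Good) (c : Fin n → ℕ) (i : Fin n) (k : ℕ) :
    ∫ v, M.alloc (Function.update v i (ε * k)) i ∂(cellMeas κ c) ≤
    resX κ M (Function.update c i k) i := by
  rw [← resZ κ hM c i k]
  refine integral_mono_ae (alloc_upd_int hM _ i _) (alloc_int hM _ i) ?_
  filter_upwards [cell_ae κ hκ (Function.update c i k)] with v hv
  have hv0 : ∀ j, 0 ≤ v j := fun j => le_trans (by positivity) (hv j).1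
  have h1 := (hv i).1
  simp only [Function.update_self] at h1
  have := alloc_mono hM i (Function.update v i (ε * k)) (by
    intro j
    by_cases h : j = i
    · subst h; simp; positivity
    · simp [h, hv0 j]) (v i) (by simpa using h1)
  simpa using this

lemma resX_ok (hε : 0 < ε) [∀ i k, IsProbabilityMeasure (κ i k)]
    (hκ : ∀ (i : Fin n) (k : ℕ), ∀ᵐ t ∂(κ i k), t ∈ Set.Ico (ε * k) (ε * (k + 1)))
    {M : Mech n} (hM : M.Good) : StepOK (resX κ M) := by
  refine ⟨fun c i => integral_nonneg fun v => ((hM.1 v).1 i).1, fun c => ?_, fun c i => ?_⟩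
  · unfold resX
    rw [← integral_finsetSum _ fun i _ => alloc_int hM _ i]
    have := integral_mono (μ := cellMeas κ c) (integrable_finsetSum _ fun i _ => alloc_int hM _ i)
      (integrable_const (1 : ℝ)) (fun v => (hM.1 v).2)
    simpa using this
  · exact monotone_nat_of_le_succ fun k =>
      (resX_le κ hε hκ hM c i k).trans (le_resX κ hε hκ hM c i (k + 1))

lemma cell_rev (hε : 0 < ε) [∀ i k, IsProbabilityMeasure (κ i k)]
    (hκ : ∀ (i : Fin n) (k : ℕ), ∀ᵐ t ∂(κ i k), t ∈ Set.Ico (ε * k) (ε * (k + 1)))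
    {M : Mech n} (hM : M.Good) (c : Fin n → ℕ)
    (hi : Integrable (fun v => ∑ i, M.pay v i) (cellMeas κ c)) :
    ∫ v, ∑ i, M.pay v i ∂(cellMeas κ c) ≤ ∑ i, spay ε (resX κ M) c i + ε := by
  let q : Fin n → (Fin n → ℝ) → ℝ := fun i v => ε * (((c i : ℝ) + 1) * M.alloc v i
      - ∑ j ∈ Finset.range (c i + 1), M.alloc (Function.update v i (ε * j)) i)
  have hs : ∀ i, Integrable (fun v => ∑ j ∈ Finset.range (c i + 1),
      M.alloc (Function.update v i (ε * j)) i) (cellMeas κ c) := fun i =>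
    integrable_finsetSum _ fun j _ => alloc_upd_int hM _ i _
  have hq : ∀ i, Integrable (q i) (cellMeas κ c) := fun i =>
    (((alloc_int hM _ i).const_mul _).sub (hs i)).const_mul ε
  have h1 : ∫ v, ∑ i, M.pay v i ∂(cellMeas κ c) ≤ ∫ v, ∑ i, q i v ∂(cellMeas κ c) := by
    refine integral_mono_ae hi (integrable_finsetSum _ fun i _ => hq i) ?_
    filter_upwards [cell_ae κ hκ c] with v hv
    refine Finset.sum_le_sum fun i _ => ?_
    exact pay_bound hε hM i v (fun j => le_trans (by positivity) (hv j).1) _ (hv i).1 (hv i).2.le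
  have h2 : ∀ i, ∫ v, q i v ∂(cellMeas κ c) ≤ spay ε (resX κ M) c i + ε * resX κ M c i := by
    intro i
    simp only [q]
    rw [integral_const_mul, integral_sub ((alloc_int hM _ i).const_mul _) (hs i), integral_const_mul,
      integral_finsetSum _ fun j _ => alloc_upd_int hM _ i _, Finset.sum_range_succ']
    have h3 : ∑ j ∈ Finset.range (c i), resX κ M (Function.update c i j) i ≤
      ∑ j ∈ Finset.range (c i),
        ∫ v, M.alloc (Function.update v i (ε * (j + 1 : ℕ))) i ∂(cellMeas κ c) :=
      Finset.sum_le_sum fun j _ => resX_le κ hε hκ hM c i j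
    have h4 : 0 ≤ ∫ v, M.alloc (Function.update v i (ε * (0 : ℕ))) i ∂(cellMeas κ c) :=
      integral_nonneg fun v => ((hM.1 _).1 i).1
    unfold spay
    rw [← mul_add]
    refine mul_le_mul_of_nonneg_left ?_ hε.le
    change ((c i : ℝ) + 1) * resX κ M c i - _ ≤ _
    linarith
  have h5 := (resX_ok κ hε hκ hM).sum_le c
  rw [integral_finsetSum _ fun i _ => hq i] at h1
  have h6 := Finset.sum_le_sum fun i (_ : i ∈ Finset.univ) => h2 i
  rw [Finset.sum_add_distrib, ← Finset.mul_sum] at h6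
  nlinarith

end resample

/-- conditional distribution on a bucket -/
noncomputable def bucketKer {n : ℕ} (ε : ℝ) (D : Fin n → Measure ℝ) (i : Fin n) (k : ℕ) : Measure ℝ :=
  open Classical in
  if D i (Set.Ico (ε * k) (ε * (k + 1))) = 0 then Measure.dirac (ε * k)
  else ProbabilityTheory.cond (D i) (Set.Ico (ε * k) (ε * (k + 1)))

lemma bucketKer_prob {n : ℕ} (ε : ℝ) (D : Fin n → Measure ℝ) [∀ i, IsProbabilityMeasure (D i)]
    (i : Fin n) (k : ℕ) : IsProbabilityMeasure (bucketKer ε D i k) := by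
  unfold bucketKer
  split_ifs with h
  · infer_instance
  · exact ProbabilityTheory.cond_isProbabilityMeasure h

lemma bucketKer_ae {n : ℕ} {ε : ℝ} (hε : 0 < ε) (D : Fin n → Measure ℝ)
    [∀ i, IsProbabilityMeasure (D i)] (i : Fin n) (k : ℕ) :
    ∀ᵐ t ∂(bucketKer ε D i k), t ∈ Set.Ico (ε * k) (ε * (k + 1)) := by
  unfold bucketKer
  split_ifs with h
  · refine (ae_dirac_iff (p := fun t => t ∈ Set.Ico (ε * (k : ℝ)) (ε * (k + 1))) measurableSet_Ico).2 ?_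
    constructor
    · exact le_rfl
    · nlinarith
  · exact ProbabilityTheory.ae_cond_mem measurableSet_Ico

lemma restrict_box {n : ℕ} (ε : ℝ) (D : Fin n → Measure ℝ) [∀ i, IsProbabilityMeasure (D i)]
    (c : Fin n → ℕ) :
    ∃ m : ENNReal, m ≠ ⊤ ∧
      (Measure.pi D).restrict (Set.univ.pi fun i => Set.Ico (ε * c i) (ε * (c i + 1)))
      = m • cellMeas (bucketKer ε D) c ∧ (m ≠ 0 → cellMeas (bucketKer ε D) c ≪ Measure.pi D ∧
        cellMeas (bucketKer ε D) c = m⁻¹ • 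
        (Measure.pi D).restrict (Set.univ.pi fun i => Set.Ico (ε * c i) (ε * (c i + 1)))) := by
  set B : Fin n → Set ℝ := fun i => Set.Ico (ε * c i) (ε * (c i + 1)) with hB
  by_cases h : ∃ i, D i (B i) = 0
  · refine ⟨0, by simp, ?_, by simp⟩
    rw [zero_smul, Measure.restrict_eq_zero, Measure.pi_pi]
    obtain ⟨i, hi⟩ := h
    exact Finset.prod_eq_zero (Finset.mem_univ i) hi
  · push Not at h
    set m := ∏ i, D i (B i) with hm
    have hm0 : m ≠ 0 := Finset.prod_ne_zero_iff.2 fun i _ => h i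
    have hmt : m ≠ ⊤ := ENNReal.prod_ne_top fun i _ => measure_ne_top _ _
    have e : cellMeas (bucketKer ε D) c = m⁻¹ • (Measure.pi D).restrict (Set.univ.pi B) := by
      unfold cellMeas
      have := bucketKer_prob ε D
      refine Measure.pi_eq fun s hs => ?_
      have hk : ∀ i, bucketKer ε D i (c i) = (D i (B i))⁻¹ • (D i).restrict (B i) := by
        intro i
        unfold bucketKer
        rw [if_neg (h i)]
        rfl
      simp only [hk, Measure.smul_apply, smul_eq_mul, Finset.prod_mul_distrib]
      rw [Measure.restrict_pi_pi, Measure.pi_pi, hm,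
        ENNReal.prod_inv_distrib]
      intro i _ j _ _
      exact Or.inr (measure_ne_top _ _)
    refine ⟨m, hmt, ?_, fun _ => ⟨?_, e⟩⟩
    · rw [e, smul_smul, ENNReal.mul_inv_cancel hm0 hmt, one_smul]
    · rw [e]
      exact Measure.smul_absolutelyContinuous.trans Measure.absolutelyContinuous_restrict

noncomputable def roundDown {n : ℕ} (ε : ℝ) (v : Fin n → ℝ) : Fin n → ℝ := fun i => ε * ⌊v i / ε⌋

lemma measurable_round1 (ε : ℝ) : Measurable fun v : ℝ => ε * (⌊v / ε⌋ : ℝ) := by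
  fun_prop

lemma measurable_roundDown {n : ℕ} (ε : ℝ) : Measurable (roundDown (n := n) ε) :=
  measurable_pi_lambda _ fun i => (measurable_round1 ε).comp (measurable_pi_apply i)

lemma cell_roundDown {n : ℕ} {ε : ℝ} (hε : 0 < ε) (v : Fin n → ℝ) :
    cell ε (roundDown ε v) = cell ε v := by
  ext i
  simp only [cell, roundDown]
  rw [mul_div_cancel_left₀ _ hε.ne', ← Int.floor_toNat, ← Int.floor_toNat, Int.floor_intCast]

lemma roundDown_eq {n : ℕ} {ε : ℝ} (hε : 0 < ε) (v : Fin n → ℝ) (hv : ∀ i, 0 ≤ v i) :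
    roundDown ε v = fun i => ε * (cell ε v i : ℝ) := by
  ext i
  simp only [cell, roundDown]
  rw [natCast_floor_eq_intCast_floor (div_nonneg (hv i) hε.le)]

lemma grid_ok {n : ℕ} {ε : ℝ} (hε : 0 < ε) {M : Mech n} (hM : M.Good) :
    StepOK (fun c : Fin n → ℕ => M.alloc (fun i => ε * (c i : ℝ))) := by
  have e : ∀ (c : Fin n → ℕ) i (k : ℕ), (fun l => ε * (Function.update c i k l : ℝ)) =
      Function.update (fun l => ε * (c l : ℝ)) i (ε * k) := by
    intro c i k; ext l
    by_cases hl : l = i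
    · subst hl; simp
    · simp [hl]
  refine ⟨fun c i => ((hM.1 _).1 i).1, fun c => (hM.1 _).2, fun c i a b hab => ?_⟩
  have := alloc_mono hM i (fun l => ε * (Function.update c i a l : ℝ)) (fun j => by positivity) (ε * b)
    (by simp; gcongr)
  simp only [e, Function.update_idem] at this ⊢
  exact this

lemma grid_pay {n : ℕ} {ε : ℝ} (hε : 0 < ε) {M : Mech n} (hM : M.Good) (c : Fin n → ℕ) (i : Fin n) :
    M.pay (fun i => ε * (c i : ℝ)) i ≤
      spay ε (fun c : Fin n → ℕ => M.alloc (fun i => ε * (c i : ℝ))) c i := by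
  have e : ∀ (c : Fin n → ℕ) i (k : ℕ), (fun l => ε * (Function.update c i k l : ℝ)) =
      Function.update (fun l => ε * (c l : ℝ)) i (ε * k) := by
    intro c i k; ext l
    by_cases hl : l = i
    · subst hl; simp
    · simp [hl]
  have := util_grid hε hM i (fun l => ε * (c l : ℝ)) (fun j => by positivity) (c i)
  have e2 : Function.update (fun l => ε * (c l : ℝ)) i (ε * (c i : ℝ)) = fun l => ε * (c l : ℝ) :=
    Function.update_eq_self i (fun l => ε * (c l : ℝ))
  rw [e2] at this
  simp only [spay, e]
  linarith

/-- **Additive discretization of the value space.** Rounding each coordinate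
distribution of a product distribution `D'` on `[0,∞)ⁿ` down to the closest
multiple of `ε` loses at most `ε` of the optimal revenue. -/
theorem opt_additive_discretization {n : ℕ} (hn : 1 ≤ n) (ε : ℝ) (hε : 0 < ε)
    (D' : Fin n → Measure ℝ)
    (hprob : ∀ i, IsProbabilityMeasure (D' i))
    (hnonneg : ∀ i, D' i (Set.Iio 0) = 0) :
    Opt (Measure.pi fun i => Measure.map (fun v : ℝ => ε * ⌊v / ε⌋) (D' i))
      ≥ Opt (Measure.pi D') - ε := by
  have hnn : ∀ᵐ v ∂(Measure.pi D'), ∀ i, 0 ≤ v i := by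
    rw [ae_all_iff]
    intro i
    refine (measurePreserving_eval D' i).quasiMeasurePreserving.ae (p := fun t => 0 ≤ t) ?_
    rw [ae_iff]
    simpa [Set.Iio] using hnonneg i
  have hmp : ∀ i, IsProbabilityMeasure ((D' i).map (fun v : ℝ => ε * (⌊v / ε⌋ : ℝ))) := fun i =>
    Measure.isProbabilityMeasure_map (measurable_round1 ε).aemeasurable
  have hpush : (Measure.pi fun i => Measure.map (fun v : ℝ => ε * (⌊v / ε⌋ : ℝ)) (D' i)) =
      (Measure.pi D').map (roundDown ε) :=
    (Measure.pi_map_pi fun i => (measurable_round1 ε).aemeasurable).symm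
  rw [hpush]
  set P := Measure.pi D' with hP
  have hprobR : IsProbabilityMeasure (P.map (roundDown ε)) :=
    Measure.isProbabilityMeasure_map (measurable_roundDown ε).aemeasurable
  set S1 := {r : ℝ | ∃ M : Mech n, M.Good ∧ r = Rev M P} with hS1
  set S2 := {r : ℝ | ∃ M : Mech n, M.Good ∧ r = Rev M (P.map (roundDown ε))} with hS2
  have hO2 := zero_le_Opt (P.map (roundDown ε))
  have hO1 := zero_le_Opt P
  by_cases hb1 : BddAbove S1
  swap
  · have : Opt P = 0 := Real.sSup_of_not_bddAbove hb1
    rw [this]; linarith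
  have hpm : ∀ M : Mech n, M.Good → Measurable fun v => ∑ i, M.pay v i := fun M hM =>
    Finset.measurable_sum _ fun i _ => hM.2.2.2.2 i
  have hb2 : BddAbove S2 := by
    refine ⟨Opt P, ?_⟩
    rintro r ⟨M, hM, rfl⟩
    unfold Rev
    rw [integral_map (measurable_roundDown ε).aemeasurable (hpm M hM).aestronglyMeasurable]
    by_cases hi : Integrable (fun v => ∑ i, M.pay (roundDown ε v) i) P
    swap
    · rw [integral_undef hi]; exact hO1
    have hok := grid_ok hε hM
    refine le_trans ?_ (le_csSup hb1 ⟨_, step_good hε hok, rfl⟩)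
    refine integral_mono_ae hi (step_integrable hε hok P hb1) ?_
    filter_upwards [hnn] with v hv
    rw [roundDown_eq hε v hv]
    exact Finset.sum_le_sum fun i _ => grid_pay hε hM _ i
  suffices h : Opt P ≤ Opt (P.map (roundDown ε)) + ε by linarith
  refine Real.sSup_le ?_ (by linarith)
  rintro r ⟨M, hM, rfl⟩
  by_cases hi : Integrable (fun v => ∑ i, M.pay v i) P
  swap
  · unfold Rev; rw [integral_undef hi]; linarith
  have := bucketKer_prob ε D'
  have hae := bucketKer_ae hε D'
  set κ := bucketKer ε D' with hκ
  have hok := resX_ok κ hε hae hM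
  have h1 : Rev (stepMech ε (resX κ M)) (P.map (roundDown ε)) ≤ Opt (P.map (roundDown ε)) :=
    le_csSup hb2 ⟨_, step_good hε hok, rfl⟩
  have h2 : Rev (stepMech ε (resX κ M)) (P.map (roundDown ε)) =
      ∫ v, ∑ i, spay ε (resX κ M) (cell ε v) i ∂P := by
    unfold Rev
    rw [integral_map (measurable_roundDown ε).aemeasurable
      (hpm _ (step_good hε hok)).aestronglyMeasurable]
    simp only [stepMech, cell_roundDown hε]
  have hR : Integrable (fun v => ∑ i, spay ε (resX κ M) (cell ε v) i) P :=
    step_integrable hε hok P hb1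
  let g : (Fin n → ℝ) → ℝ := fun v =>
    ∑ i, M.pay v i - (∑ i, spay ε (resX κ M) (cell ε v) i + ε)
  have hg : Integrable g P := hi.sub (hR.add (integrable_const ε))
  have hgi : ∫ v, g v ∂P = Rev M P - (∫ v, ∑ i, spay ε (resX κ M) (cell ε v) i ∂P + ε) := by
    simp only [g]
    have hRe : Integrable (fun v => ∑ i, spay ε (resX κ M) (cell ε v) i + ε) P :=
      hR.add (integrable_const ε)
    rw [integral_sub hi hRe, integral_add hR (integrable_const ε)]
    simp [Rev]
  suffices hle : ∫ v, g v ∂P ≤ 0 by linarith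
  have hun : (⋃ c : Fin n → ℕ, cell ε ⁻¹' {c}) = (Set.univ : Set (Fin n → ℝ)) := by
    ext v; simp
  rw [← setIntegral_univ, ← hun, integral_iUnion (fun c => measurable_cell ε (measurableSet_singleton c))
    (fun a b hab => Disjoint.preimage _ (by simpa using hab)) hg.integrableOn]
  refine tsum_nonpos fun c => ?_
  have hset : (cell ε ⁻¹' {c} : Set (Fin n → ℝ)) =ᵐ[P]
      (Set.univ.pi fun i => Set.Ico (ε * (c i : ℝ)) (ε * (c i + 1))) := by
    filter_upwards [hnn] with v hv
    refine propext ?_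
    change cell ε v = c ↔ v ∈ Set.univ.pi _
    rw [Set.mem_univ_pi, funext_iff]
    refine forall_congr' fun i => ?_
    rw [cell, Nat.floor_eq_iff (div_nonneg (hv i) hε.le), le_div_iff₀ hε, div_lt_iff₀ hε, Set.mem_Ico,
      mul_comm ε, mul_comm ε]
  rw [setIntegral_congr_set hset]
  obtain ⟨m, hmt, hm1, hm2⟩ := restrict_box ε D' c
  rw [hm1, integral_smul_measure]
  by_cases hm0 : m = 0
  · simp [hm0]
  obtain ⟨-, hm3⟩ := hm2 hm0
  refine smul_nonpos_of_nonneg_of_nonpos ENNReal.toReal_nonneg ?_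
  have hic : Integrable (fun v => ∑ i, M.pay v i) (cellMeas κ c) := by
    rw [hκ, hm3]
    exact hi.restrict.smul_measure (ENNReal.inv_ne_top.2 hm0)
  have hcr := cell_rev κ hε hae hM c hic
  have hcong : ∫ v, g v ∂(cellMeas κ c) =
      ∫ v, (∑ i, M.pay v i - (∑ i, spay ε (resX κ M) c i + ε)) ∂(cellMeas κ c) := by
    refine integral_congr_ae ?_
    filter_upwards [cell_ae κ hae c] with v hv
    have : cell ε v = c := by
      ext i
      have hv0 : 0 ≤ v i := le_trans (by positivity) (hv i).1
      rw [cell, Nat.floor_eq_iff (div_nonneg hv0 hε.le), le_div_iff₀ hε, div_lt_iff₀ hε,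
        mul_comm _ ε, mul_comm _ ε]
      exact hv i
    simp only [g, this]
  rw [hcong, integral_sub hic (integrable_const _)]
  simp only [integral_const, probReal_univ, one_smul]
  linarith
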